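/- Let H be a real Hilbert space, let A_i : H → Set H (i = 1,…,r) be maximally monotone operators, let γ > 0, β ∈ (0,1), let (λ_n) be a sequence in [0,1] with ∑ λ_n(1−λ_n) = ∞, and suppose q ∈ ran(Id + (γ/(2r(1−β))) ∑_{i=1}^r A_i). Given x_{1,0},…,x_{r,0} ∈ H, define for n ≥ 0: p_n = (1/r) ∑_{i=1}^r x_{i,n} and x_{i,n+1} = (1−λ_n) x_{i,n} + λ_n (2β J_{γ(A_i)_{−q}} − Id)(2β p_n − x_{i,n}), where J_{γ(A_i)_{−q}}(x) is the unique y with x − y ∈ γ • A_i(y + q). Then each sequence (x_{i,n}) converges weakly to some x_i* ∈ H, q + (1/r) ∑_{i=1}^r x_i* = J_{(γ/(2r(1−β))) ∑ A_i}(q), and the sequence (q + p_n) converges strongly (in norm) to J_{(γ/(2r(1−β))) ∑ A_i}(q). -/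

import Mathlib

open Pointwise RealInnerProductSpace Filter Finset

/-- A set-valued operator `A : H → Set H` is monotone if
`⟪x − y, u − v⟫ ≥ 0` for all `(x,u), (y,v)` in its graph. -/
def MonotoneOp {H : Type*} [NormedAddCommGroup H] [InnerProductSpace ℝ H]
    (A : H → Set H) : Prop :=
  ∀ x y u v : H, u ∈ A x → v ∈ A y → 0 ≤ ⟪x - y, u - v⟫

/-- A set-valued operator is maximally monotone if it is monotone and `(x,u)` belongs
to its graph whenever `⟪x − y, u − v⟫ ≥ 0` for all `(y,v)` in its graph. -/
def MaxMonotoneOp {H : Type*} [NormedAddCommGroup H] [InnerProductSpace ℝ H]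
    (A : H → Set H) : Prop :=
  MonotoneOp A ∧ ∀ x u : H, (∀ y v : H, v ∈ A y → 0 ≤ ⟪x - y, u - v⟫) → u ∈ A x

/-- The range of `Id + A`: `ran(Id + A) = {x + u | x ∈ H, u ∈ A x}`. -/
def ranIdAdd {H : Type*} [AddCommGroup H] (A : H → Set H) : Set H :=
  {y | ∃ x : H, ∃ u ∈ A x, y = x + u}


section KrasnoselskiiMann

variable {E : Type*} [NormedAddCommGroup E] [InnerProductSpace ℝ E]

/-- A bounded sequence in a Hilbert space converges weakly along every ultrafilter. -/
theorem exists_weak_limit_ultrafilter [CompleteSpace E] {ι : Type*} (U : Ultrafilter ι)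
    (x : ι → E) (C : ℝ) (hC : ∀ n, ‖x n‖ ≤ C) :
    ∃ y : E, ∀ z : E, Tendsto (fun n => ⟪x n, z⟫) U (nhds ⟪y, z⟫) := by
  have hb : ∀ z n, |⟪x n, z⟫| ≤ C * ‖z‖ := fun z n =>
    (abs_real_inner_le_norm _ _).trans (mul_le_mul_of_nonneg_right (hC n) (norm_nonneg _))
  have hlim : ∀ z, ∃ l : ℝ, Tendsto (fun n => ⟪x n, z⟫) U (nhds l) := by
    intro z
    obtain ⟨l, -, hl⟩ := (isCompact_Icc (a := -(C * ‖z‖)) (b := C * ‖z‖)).ultrafilter_le_nhds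
      (U.map fun n => ⟪x n, z⟫)
      (le_principal_iff.2 (Filter.mem_map.2 (Filter.univ_mem' fun n => abs_le.1 (hb z n))))
    exact ⟨l, hl⟩
  choose l hl using hlim
  let L : E →ₗ[ℝ] ℝ :=
    { toFun := l
      map_add' := fun a b => tendsto_nhds_unique (hl (a + b))
        (((hl a).add (hl b)).congr fun n => (inner_add_right _ _ _).symm)
      map_smul' := fun c a => tendsto_nhds_unique (hl (c • a))
        (((hl a).const_mul c).congr fun n => (real_inner_smul_right _ _ _).symm) }
  let F : E →L[ℝ] ℝ := L.mkContinuous C fun z => by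
    exact le_of_tendsto (hl z).norm (Filter.Eventually.of_forall (hb z))
  refine ⟨(InnerProductSpace.toDual ℝ E).symm F, fun z => ?_⟩
  rw [InnerProductSpace.toDual_symm_apply]
  exact hl z

theorem norm_sq_convexCombination (a b : E) (t : ℝ) :
    ‖(1 - t) • a + t • b‖ ^ 2 =
      (1 - t) * ‖a‖ ^ 2 + t * ‖b‖ ^ 2 - t * (1 - t) * ‖b - a‖ ^ 2 := by
  rw [norm_add_sq_real, norm_sub_sq_real, norm_smul, norm_smul, mul_pow, mul_pow,
    Real.norm_eq_abs, Real.norm_eq_abs, sq_abs, sq_abs, real_inner_smul_left,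
    real_inner_smul_right, real_inner_comm a b]
  ring

/-- Demiclosedness of `Id - T` at `0` for a nonexpansive `T`, along an arbitrary filter. -/
theorem fixedPoint_of_weak_limit {ι : Type*} {l : Filter ι} [l.NeBot] {T : E → E}
    (hT : ∀ v w, ‖T v - T w‖ ≤ ‖v - w‖) {x : ι → E} {C : ℝ} {y : E} (hC : ∀ n, ‖x n - y‖ ≤ C)
    (hy : ∀ z : E, Tendsto (fun n => ⟪x n, z⟫) l (nhds ⟪y, z⟫))
    (hres : Tendsto (fun n => ‖T (x n) - x n‖) l (nhds 0)) : T y = y := by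
  have hw : Tendsto (fun n => ‖y - T y‖ ^ 2 + 2 * (⟪x n, y - T y⟫ - ⟪y, y - T y⟫)) l
      (nhds (‖y - T y‖ ^ 2 + 2 * (⟪y, y - T y⟫ - ⟪y, y - T y⟫))) :=
    (((hy _).sub_const _).const_mul 2).const_add _
  have hu : Tendsto (fun n => ‖T (x n) - x n‖ ^ 2 + 2 * C * ‖T (x n) - x n‖) l
      (nhds (0 ^ 2 + 2 * C * 0)) := (hres.pow 2).add (hres.const_mul _)
  have hle := le_of_tendsto_of_tendsto' hw hu fun n => by
    have h1 : ‖x n - T y‖ ≤ ‖T (x n) - x n‖ + ‖x n - y‖ := by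
      have h := norm_sub_le_norm_sub_add_norm_sub (x n) (T (x n)) (T y)
      rw [norm_sub_rev (x n) (T (x n))] at h
      linarith [hT (x n) y]
    have h2 : ‖x n - T y‖ ^ 2 =
        ‖x n - y‖ ^ 2 + 2 * (⟪x n, y - T y⟫ - ⟪y, y - T y⟫) + ‖y - T y‖ ^ 2 := by
      rw [← inner_sub_left, ← norm_add_sq_real, sub_add_sub_cancel]
    have h3 := pow_le_pow_left₀ (norm_nonneg _) h1 2
    nlinarith [hC n, norm_nonneg (T (x n) - x n)]
  have h0 : ‖y - T y‖ = 0 := by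
    have : ‖y - T y‖ ^ 2 ≤ 0 := by linarith
    exact pow_eq_zero_iff two_ne_zero |>.1 (le_antisymm this (sq_nonneg _))
  exact (sub_eq_zero.1 (norm_eq_zero.1 h0)).symm

variable {T : E → E} {lam : ℕ → ℝ} {x : ℕ → E}

theorem krasnoselskiiMann_norm_sq_le (hT : ∀ v w, ‖T v - T w‖ ≤ ‖v - w‖)
    (hlam : ∀ n, lam n ∈ Set.Icc (0 : ℝ) 1)
    (hx : ∀ n, x (n + 1) = (1 - lam n) • x n + lam n • T (x n)) {y : E} (hy : T y = y) (n : ℕ) :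
    ‖x (n + 1) - y‖ ^ 2 ≤
      ‖x n - y‖ ^ 2 - lam n * (1 - lam n) * ‖T (x n) - x n‖ ^ 2 := by
  have h := norm_sq_convexCombination (x n - y) (T (x n) - y) (lam n)
  have e : (1 - lam n) • (x n - y) + lam n • (T (x n) - y) = x (n + 1) - y := by
    rw [hx]; module
  rw [e, sub_sub_sub_cancel_right] at h
  have h1 := hT (x n) y
  rw [hy] at h1
  have h2 := pow_le_pow_left₀ (norm_nonneg _) h1 2
  nlinarith [mul_le_mul_of_nonneg_left h2 (hlam n).1]

theorem krasnoselskiiMann_antitone_residual (hT : ∀ v w, ‖T v - T w‖ ≤ ‖v - w‖)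
    (hlam : ∀ n, lam n ∈ Set.Icc (0 : ℝ) 1)
    (hx : ∀ n, x (n + 1) = (1 - lam n) • x n + lam n • T (x n)) :
    Antitone fun n => ‖T (x n) - x n‖ := by
  refine antitone_nat_of_succ_le fun n => ?_
  have e : T (x (n + 1)) - x (n + 1) =
      (T (x (n + 1)) - T (x n)) + (1 - lam n) • (T (x n) - x n) := by
    rw [hx]; module
  have e' : x (n + 1) - x n = lam n • (T (x n) - x n) := by
    rw [hx]; module
  have h := norm_add_le (T (x (n + 1)) - T (x n)) ((1 - lam n) • (T (x n) - x n))
  have h' := hT (x (n + 1)) (x n)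
  rw [e', norm_smul, Real.norm_of_nonneg (hlam n).1] at h'
  rw [← e, norm_smul, Real.norm_of_nonneg (sub_nonneg.2 (hlam n).2)] at h
  linarith

theorem krasnoselskiiMann_antitone_dist (hT : ∀ v w, ‖T v - T w‖ ≤ ‖v - w‖)
    (hlam : ∀ n, lam n ∈ Set.Icc (0 : ℝ) 1)
    (hx : ∀ n, x (n + 1) = (1 - lam n) • x n + lam n • T (x n)) {y : E} (hy : T y = y) :
    Antitone fun n => ‖x n - y‖ ^ 2 :=
  antitone_nat_of_succ_le fun n => (krasnoselskiiMann_norm_sq_le hT hlam hx hy n).trans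
    (sub_le_self _ (mul_nonneg (mul_nonneg (hlam n).1 (sub_nonneg.2 (hlam n).2)) (sq_nonneg _)))

theorem krasnoselskiiMann_tendsto_residual (hT : ∀ v w, ‖T v - T w‖ ≤ ‖v - w‖)
    (hlam : ∀ n, lam n ∈ Set.Icc (0 : ℝ) 1)
    (hlamsum : ¬ Summable fun n => lam n * (1 - lam n))
    (hx : ∀ n, x (n + 1) = (1 - lam n) • x n + lam n • T (x n)) {y : E} (hy : T y = y) :
    Tendsto (fun n => ‖T (x n) - x n‖) atTop (nhds 0) := by
  have hanti := krasnoselskiiMann_antitone_residual hT hlam hx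
  have hnn : ∀ n, 0 ≤ lam n * (1 - lam n) := fun n =>
    mul_nonneg (hlam n).1 (sub_nonneg.2 (hlam n).2)
  rw [Metric.tendsto_atTop]
  by_contra! hcon
  obtain ⟨ε, hε, h⟩ := hcon
  have hbig : ∀ n, ε ≤ ‖T (x n) - x n‖ := fun n => by
    obtain ⟨m, hm, h'⟩ := h n
    rw [Real.dist_0_eq_abs, abs_norm] at h'
    exact h'.trans (hanti hm)
  have hsum : ∀ N, ∑ n ∈ range N, lam n * (1 - lam n) * ε ^ 2 ≤ ‖x 0 - y‖ ^ 2 - ‖x N - y‖ ^ 2 := by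
    intro N
    rw [← Finset.sum_range_sub' (fun n => ‖x n - y‖ ^ 2)]
    refine Finset.sum_le_sum fun n _ => ?_
    have h1 := krasnoselskiiMann_norm_sq_le hT hlam hx hy n
    have h2 := mul_le_mul_of_nonneg_left (pow_le_pow_left₀ hε.le (hbig n) 2) (hnn n)
    linarith
  have hs : Summable fun n => lam n * (1 - lam n) * ε ^ 2 :=
    summable_of_sum_range_le (c := ‖x 0 - y‖ ^ 2) (fun n => mul_nonneg (hnn n) (sq_nonneg _))
      fun N => (hsum N).trans (sub_le_self _ (sq_nonneg _))
  exact hlamsum ((summable_mul_right_iff (pow_ne_zero 2 hε.ne')).1 hs)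

/-- The Krasnoselskii–Mann iteration of a nonexpansive map with a fixed point converges weakly
to a fixed point. -/
theorem krasnoselskiiMann_weak_convergence [CompleteSpace E]
    (hT : ∀ v w, ‖T v - T w‖ ≤ ‖v - w‖)
    (hlam : ∀ n, lam n ∈ Set.Icc (0 : ℝ) 1)
    (hlamsum : ¬ Summable fun n => lam n * (1 - lam n))
    (hx : ∀ n, x (n + 1) = (1 - lam n) • x n + lam n • T (x n)) {y : E} (hy : T y = y) :
    ∃ w, T w = w ∧ ∀ z : E, Tendsto (fun n => ⟪x n, z⟫) atTop (nhds ⟪w, z⟫) := by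
  have hres := krasnoselskiiMann_tendsto_residual hT hlam hlamsum hx hy
  have hbdd : ∀ n, ‖x n - y‖ ≤ ‖x 0 - y‖ := fun n =>
    le_of_sq_le_sq (krasnoselskiiMann_antitone_dist hT hlam hx hy (Nat.zero_le n)) (norm_nonneg _)
  have hbdd' : ∀ v n, ‖x n - v‖ ≤ ‖x 0 - y‖ + ‖y - v‖ := fun v n =>
    (norm_sub_le_norm_sub_add_norm_sub _ y _).trans (by linarith [hbdd n])
  have hcluster : ∀ U : Ultrafilter ℕ, (U : Filter ℕ) ≤ atTop → ∃ w, T w = w ∧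
      ∀ z : E, Tendsto (fun n => ⟪x n, z⟫) U (nhds ⟪w, z⟫) := by
    intro U hU
    obtain ⟨w, hw⟩ := exists_weak_limit_ultrafilter U x _ fun n => by simpa using hbdd' 0 n
    exact ⟨w, fixedPoint_of_weak_limit hT (hbdd' w) hw (hres.mono_left hU), hw⟩
  have hdist : ∀ v, T v = v → ∃ d, Tendsto (fun n => ‖x n - v‖ ^ 2) atTop (nhds d) := fun v hv =>
    ⟨_, tendsto_atTop_ciInf (krasnoselskiiMann_antitone_dist hT hlam hx hv)
      ⟨0, by rintro _ ⟨n, rfl⟩; exact sq_nonneg _⟩⟩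
  obtain ⟨w, hTw, hw⟩ := hcluster (Ultrafilter.of atTop) (Ultrafilter.of_le _)
  refine ⟨w, hTw, fun z => (tendsto_iff_ultrafilter _ _ _).2 fun U hU => ?_⟩
  obtain ⟨v, hTv, hv⟩ := hcluster U hU
  suffices v = w by subst this; exact hv z
  obtain ⟨d₁, hd₁⟩ := hdist v hTv
  obtain ⟨d₂, hd₂⟩ := hdist w hTw
  have hlim : Tendsto (fun n => ⟪x n, v - w⟫) atTop
      (nhds ((d₂ - d₁ + ‖v‖ ^ 2 - ‖w‖ ^ 2) / 2)) := by
    refine ((((hd₂.sub hd₁).add_const _).sub_const _).div_const 2).congr fun n => ?_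
    rw [norm_sub_sq_real, norm_sub_sq_real, inner_sub_right]
    ring
  have e₁ := tendsto_nhds_unique (hv (v - w)) (hlim.mono_left hU)
  have e₂ := tendsto_nhds_unique (hw (v - w)) (hlim.mono_left (Ultrafilter.of_le _))
  rw [← sub_eq_zero, ← inner_self_eq_zero (𝕜 := ℝ), inner_sub_left, e₁, e₂, sub_self]

end KrasnoselskiiMann

section Resolvent

variable {H : Type*} [NormedAddCommGroup H] [InnerProductSpace ℝ H]

theorem MonotoneOp.norm_sq_le_inner {A : H → Set H} (hA : MonotoneOp A) {γ : ℝ} (hγ : 0 < γ)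
    {q s t a b : H} (ha : s - a ∈ γ • A (a + q)) (hb : t - b ∈ γ • A (b + q)) :
    ‖a - b‖ ^ 2 ≤ ⟪a - b, s - t⟫ := by
  obtain ⟨u, hu, hu'⟩ := ha
  obtain ⟨v, hv, hv'⟩ := hb
  have h := mul_nonneg hγ.le (hA _ _ _ _ hu hv)
  have e : s - t = (a - b) + γ • (u - v) := by
    rw [smul_sub]
    simp only at hu' hv'
    rw [hu', hv']
    abel
  rw [e, inner_add_right, real_inner_smul_right, real_inner_self_eq_norm_sq]
  rw [add_sub_add_right_eq_sub] at h
  linarith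

theorem MonotoneOp.resolvent_unique {A : H → Set H} (hA : MonotoneOp A) {γ : ℝ} (hγ : 0 < γ)
    {q s a b : H} (ha : s - a ∈ γ • A (a + q)) (hb : s - b ∈ γ • A (b + q)) : a = b := by
  have h := hA.norm_sq_le_inner hγ ha hb
  rw [sub_self, inner_zero_right] at h
  exact sub_eq_zero.1 (norm_eq_zero.1 (pow_eq_zero_iff two_ne_zero |>.1
    (le_antisymm h (sq_nonneg _))))

/-- If `J` is firmly nonexpansive then `2βJ - Id` is nonexpansive for `β ∈ [0,1]`. -/
theorem norm_two_mul_smul_sub_le {β : ℝ} (hβ₀ : 0 ≤ β) (hβ₁ : β ≤ 1) {a s : H}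
    (h : ‖a‖ ^ 2 ≤ ⟪a, s⟫) : ‖(2 * β) • a - s‖ ^ 2 ≤ ‖s‖ ^ 2 := by
  rw [norm_sub_sq_real, norm_smul, mul_pow, Real.norm_eq_abs, sq_abs, real_inner_smul_left]
  nlinarith [mul_le_mul_of_nonneg_left h hβ₀, mul_nonneg (mul_nonneg hβ₀ (sub_nonneg.2 hβ₁))
    (sq_nonneg ‖a‖)]

variable {r : ℕ}

/-- The mean of the components of a vector of the product space. -/
noncomputable def meanPi (v : PiLp 2 fun _ : Fin r => H) : H := (r : ℝ)⁻¹ • ∑ j, v j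

theorem meanPi_sub (v w : PiLp 2 fun _ : Fin r => H) :
    meanPi v - meanPi w = meanPi (v - w) := by
  simp [meanPi, smul_sub]

theorem sum_norm_sq_two_mul_smul_meanPi_sub (hr : 1 ≤ r) (β : ℝ)
    (v : PiLp 2 fun _ : Fin r => H) :
    ∑ i, ‖(2 * β) • meanPi v - v i‖ ^ 2 =
      ‖v‖ ^ 2 - 4 * β * (1 - β) * r * ‖meanPi v‖ ^ 2 := by
  have hr' : (r : ℝ) ≠ 0 := by positivity
  have hs : ∑ j, v j = (r : ℝ) • meanPi v := by rw [meanPi, smul_inv_smul₀ hr']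
  have e : ∀ i, ‖(2 * β) • meanPi v - v i‖ ^ 2 =
      (4 * β ^ 2 * ‖meanPi v‖ ^ 2 - 4 * β * ⟪meanPi v, v i⟫) + ‖v i‖ ^ 2 := fun i => by
    rw [norm_sub_sq_real, norm_smul, mul_pow, Real.norm_eq_abs, sq_abs, real_inner_smul_left]
    ring
  simp_rw [e]
  rw [Finset.sum_add_distrib, ← PiLp.norm_sq_eq_of_L2, Finset.sum_sub_distrib, ← Finset.mul_sum,
    ← Finset.mul_sum, ← inner_sum, hs, real_inner_smul_right, real_inner_self_eq_norm_sq]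
  simp only [Finset.sum_const, Finset.card_univ, Fintype.card_fin, nsmul_eq_mul]
  ring

/-- The composition of the relaxed reflections `2βJ - Id` of the product resolvent and of the
projection onto the diagonal. -/
noncomputable def relaxedReflection (β : ℝ) (J : Fin r → H → H)
    (v : PiLp 2 fun _ : Fin r => H) : PiLp 2 fun _ : Fin r => H :=
  WithLp.toLp 2 fun i =>
    (2 * β) • J i ((2 * β) • meanPi v - v i) - ((2 * β) • meanPi v - v i)

theorem norm_sq_relaxedReflection_sub_le (hr : 1 ≤ r) {β : ℝ} (hβ₀ : 0 ≤ β) (hβ₁ : β ≤ 1)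
    {J : Fin r → H → H} (hJ : ∀ i s t, ‖J i s - J i t‖ ^ 2 ≤ ⟪J i s - J i t, s - t⟫)
    (v w : PiLp 2 fun _ : Fin r => H) :
    ‖relaxedReflection β J v - relaxedReflection β J w‖ ^ 2 ≤
      ‖v - w‖ ^ 2 - 4 * β * (1 - β) * r * ‖meanPi v - meanPi w‖ ^ 2 := by
  rw [meanPi_sub, ← sum_norm_sq_two_mul_smul_meanPi_sub hr, PiLp.norm_sq_eq_of_L2]
  refine Finset.sum_le_sum fun i _ => ?_
  have h := norm_two_mul_smul_sub_le hβ₀ hβ₁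
    (hJ i ((2 * β) • meanPi v - v i) ((2 * β) • meanPi w - w i))
  have e₁ : (relaxedReflection β J v - relaxedReflection β J w) i =
      (2 * β) • (J i ((2 * β) • meanPi v - v i) - J i ((2 * β) • meanPi w - w i)) -
        ((2 * β) • meanPi v - v i - ((2 * β) • meanPi w - w i)) := by
    simp only [relaxedReflection, PiLp.sub_apply]
    module
  have e₂ : (2 * β) • meanPi (v - w) - (v - w) i =
      (2 * β) • meanPi v - v i - ((2 * β) • meanPi w - w i) := by
    rw [← meanPi_sub, PiLp.sub_apply]
    module
  rwa [e₁, e₂]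

end Resolvent

theorem stmt17 {H : Type*} [NormedAddCommGroup H] [InnerProductSpace ℝ H] [CompleteSpace H]
    (r : ℕ) (hr : 1 ≤ r)
    (A : Fin r → H → Set H) (hA : ∀ i, MaxMonotoneOp (A i))
    (γ β : ℝ) (hγ : 0 < γ) (hβ : β ∈ Set.Ioo (0 : ℝ) 1)
    (lam : ℕ → ℝ) (hlam : ∀ n, lam n ∈ Set.Icc (0 : ℝ) 1)
    (hlamsum : ¬ Summable (fun n => lam n * (1 - lam n)))
    (q : H)
    (hq : q ∈ ranIdAdd (fun x : H => (γ / (2 * (r : ℝ) * (1 - β))) • ∑ i, A i x))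
    -- `J i = J_{γ(Aᵢ)₋q}`: the (single-valued) resolvent of the inner
    -- (−q)-perturbation of `γAᵢ`.
    (J : Fin r → H → H)
    (hJ : ∀ i, ∀ s : H, s - J i s ∈ γ • A i (J i s + q))
    (x : Fin r → ℕ → H) (p : ℕ → H)
    (hp : ∀ n, p n = ((r : ℝ)⁻¹) • ∑ i, x i n)
    (hx : ∀ i n, x i (n + 1) = (1 - lam n) • x i n +
        lam n • ((2 * β) • J i ((2 * β) • p n - x i n) - ((2 * β) • p n - x i n))) :
    ∃ (xs : Fin r → H) (P : H),
      -- each `(x i n)` converges weakly to `xs i`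
      (∀ i, ∀ z : H, Tendsto (fun n => ⟪x i n, z⟫) atTop (nhds ⟪xs i, z⟫)) ∧
      -- `P = J_{(γ/(2r(1−β)))∑ᵢAᵢ}(q)`
      q - P ∈ (γ / (2 * (r : ℝ) * (1 - β))) • ∑ i, A i P ∧
      q + ((r : ℝ)⁻¹) • ∑ i, xs i = P ∧
      -- `(q + p n)` converges strongly to `P`
      Tendsto (fun n => q + p n) atTop (nhds P) := by
  obtain ⟨hβ₀, hβ₁⟩ := hβ
  have hr' : (0 : ℝ) < r := by exact_mod_cast hr
  have hβ' : 0 < 1 - β := sub_pos.2 hβ₁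
  have hJf : ∀ i s t, ‖J i s - J i t‖ ^ 2 ≤ ⟪J i s - J i t, s - t⟫ := fun i s t =>
    (hA i).1.norm_sq_le_inner hγ (hJ i s) (hJ i t)
  set T := relaxedReflection β J with hTdef
  have hTsq := norm_sq_relaxedReflection_sub_le hr hβ₀.le hβ₁.le hJf
  have hT : ∀ v w, ‖T v - T w‖ ≤ ‖v - w‖ := fun v w =>
    le_of_sq_le_sq ((hTsq v w).trans (sub_le_self _ (by positivity))) (norm_nonneg _)
  set X : ℕ → PiLp 2 fun _ : Fin r => H := fun n => WithLp.toLp 2 fun i => x i n with hXdef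
  have hXp : ∀ n, meanPi (X n) = p n := fun n => (hp n).symm
  have hX : ∀ n, X (n + 1) = (1 - lam n) • X n + lam n • T (X n) := fun n => by
    ext i
    simp only [PiLp.add_apply, PiLp.smul_apply, hTdef, relaxedReflection, hXp]
    exact hx i n
  obtain ⟨a, b, ⟨b', hb', hbb'⟩, hqab⟩ := hq
  obtain ⟨u, hu, hub⟩ := (Set.mem_finsetSum _ _ _).1 hb'
  let y : PiLp 2 fun _ : Fin r => H := WithLp.toLp 2 fun i =>
    (2 * β) • (a - q) - (a - q + γ • u i)
  have hymean : meanPi y = a - q := by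
    have e : a - q = -(γ / (2 * (r : ℝ) * (1 - β))) • ∑ i, u i := by
      rw [hub, hqab, ← hbb']
      module
    simp only [meanPi, y, Finset.sum_sub_distrib, Finset.sum_add_distrib, ← Finset.smul_sum,
      Finset.sum_const, Finset.card_univ, Fintype.card_fin, ← Nat.cast_smul_eq_nsmul ℝ, e]
    match_scalars
    field_simp
    ring
  have hy : T y = y := by
    ext i
    have e : (2 * β) • meanPi y - y i = a - q + γ • u i := by
      rw [hymean]
      simp only [y]
      abel
    have e' : J i (a - q + γ • u i) = a - q := by
      refine (hA i).1.resolvent_unique hγ (hJ i _) ?_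
      rw [add_sub_cancel_left, sub_add_cancel]
      exact Set.smul_mem_smul_set (hu (Finset.mem_univ i))
    simp only [hTdef, relaxedReflection, e, e', y]
  obtain ⟨w, hTw, hw⟩ := krasnoselskiiMann_weak_convergence hT hlam hlamsum hX hy
  have hres := krasnoselskiiMann_tendsto_residual hT hlam hlamsum hX hTw
  refine ⟨fun i => w i, q + meanPi w, fun i z => ?_, ?_, rfl, ?_⟩
  · have h := hw (WithLp.toLp 2 (Pi.single i z))
    have e : ∀ v : PiLp 2 fun _ : Fin r => H,
        ⟪v, (WithLp.toLp 2 (Pi.single i z) : PiLp 2 fun _ : Fin r => H)⟫ = ⟪v i, z⟫ := fun v => by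
      rw [PiLp.inner_apply, Finset.sum_eq_single i (fun j _ hj => by simp [hj]) (by simp)]
      simp
    simpa only [e] using h
  · have hmem : ∀ i, (2 * β) • meanPi w - w i - meanPi w ∈ γ • A i (q + meanPi w) := by
      intro i
      have e : (2 * β) • J i ((2 * β) • meanPi w - w i) - ((2 * β) • meanPi w - w i) = w i :=
        congrArg (fun v : PiLp 2 fun _ : Fin r => H => v i) hTw
      have e' : J i ((2 * β) • meanPi w - w i) = meanPi w := by
        rw [sub_eq_iff_eq_add, add_sub_cancel] at e
        exact smul_right_injective H (mul_pos two_pos hβ₀).ne' e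
      have h := hJ i ((2 * β) • meanPi w - w i)
      rwa [e', add_comm (meanPi w)] at h
    choose g hg hg' using hmem
    simp only at hg'
    refine ⟨∑ i, g i, (Set.mem_finsetSum _ _ _).2 ⟨g, fun {i} _ => hg i, rfl⟩, ?_⟩
    have hs : ∑ j, w j = (r : ℝ) • meanPi w := by rw [meanPi, smul_inv_smul₀ hr'.ne']
    have hsum : γ • ∑ i, g i = -(2 * (r : ℝ) * (1 - β)) • meanPi w := by
      rw [Finset.smul_sum, Finset.sum_congr rfl fun i _ => hg' i]
      simp only [Finset.sum_sub_distrib, hs, Finset.sum_const, Finset.card_univ,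
        Fintype.card_fin, ← Nat.cast_smul_eq_nsmul ℝ]
      module
    simp only
    rw [div_eq_inv_mul, mul_smul, hsum, neg_smul, smul_neg, inv_smul_smul₀ (by positivity)]
    abel
  · refine Tendsto.const_add q ?_
    rw [tendsto_iff_norm_sub_tendsto_zero]
    have hc : 0 < 4 * β * (1 - β) * r := by positivity
    have hD : ∀ n, ‖X n - w‖ ≤ ‖X 0 - w‖ := fun n =>
      le_of_sq_le_sq (krasnoselskiiMann_antitone_dist hT hlam hX hTw (Nat.zero_le n)) (norm_nonneg _)
    have hub : ∀ n, ‖p n - meanPi w‖ ^ 2 ≤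
        2 * ‖X 0 - w‖ * ‖T (X n) - X n‖ / (4 * β * (1 - β) * r) := fun n => by
      rw [le_div_iff₀ hc]
      have h₁ := hTsq (X n) w
      rw [← hTdef, hTw, hXp] at h₁
      have h₂ : ‖X n - w‖ ≤ ‖T (X n) - X n‖ + ‖T (X n) - w‖ := by
        rw [norm_sub_rev (T (X n)) (X n)]
        exact norm_sub_le_norm_sub_add_norm_sub _ _ _
      have h₃ := hT (X n) w
      rw [hTw] at h₃
      nlinarith [hD n, norm_nonneg (T (X n) - X n), norm_nonneg (T (X n) - w)]
    have hsq : Tendsto (fun n => ‖p n - meanPi w‖ ^ 2) atTop (nhds 0) := by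
      refine squeeze_zero (fun n => sq_nonneg _) hub ?_
      simpa using (hres.const_mul (2 * ‖X 0 - w‖)).div_const (4 * β * (1 - β) * r)
    simpa [Real.sqrt_sq] using hsq.sqrt
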